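/- Let ℓ ≥ 9 be an odd integer and let m ∈ {(ℓ−3)/2, (ℓ−1)/2, …, ℓ−3}. Then there exists an ℓ-cycle C with vertices in Z_{2ℓ} × {0,1} containing exactly (ℓ−3)/2 edges of pairwise distinct 0-pure differences, exactly (ℓ−1)/2 edges of pairwise distinct 1-pure differences, and exactly two mixed edges, of mixed differences 0 and ℓ, such that: (i) C contains no edge of 0-pure difference ±2, ±m or ℓ, and no edge of 1-pure difference ±m or ℓ; (ii) for every x ∈ Z_{2ℓ}, if x_0 is a vertex of C then x_1 is also a vertex of C; (iii) C and all of its translates by elements t ∈ Z_{2ℓ} are equitably 2-coloured under the standard colouring. Moreover, for ℓ = 7 such a cycle exists with m = 3. -/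

import Mathlib

/-- Vertices: `a_i` is the pair `(a, i)` with `a : ZMod (2ℓ)` and `i : Bool`
(part `0` is `false`, part `1` is `true`). -/
abbrev Pt (ℓ : ℕ) := ZMod (2 * ℓ) × Bool

/-- The standard colouring (red = `true`): `a_0` is red iff `0 ≤ a ≤ ℓ-1`,
and `a_1` is red iff `ℓ ≤ a ≤ 2ℓ-1`. -/
def stdColour (ℓ : ℕ) (x : Pt ℓ) : Bool :=
  xor (decide (x.1.val < ℓ)) x.2

/-- The edge of the cycle `c` from its `j`-th to its `(j+1)`-st vertex is mixed
(its endpoints lie in different parts). -/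
abbrev mixedEdge {ℓ : ℕ} (c : ZMod ℓ → Pt ℓ) (j : ZMod ℓ) : Prop :=
  (c j).2 ≠ (c (j + 1)).2

/-- The mixed difference of the `j`-th edge of `c` (oriented from the part-`0`
endpoint `a_0` to the part-`1` endpoint `b_1`, giving `b - a`). -/
def mixedDiff {ℓ : ℕ} (c : ZMod ℓ → Pt ℓ) (j : ZMod ℓ) : ZMod (2 * ℓ) :=
  if (c j).2 = false then (c (j + 1)).1 - (c j).1 else (c j).1 - (c (j + 1)).1

/-- The `j`-th edge of `c` is `i`-pure: both endpoints lie in part `i`. -/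
abbrev pureEdge {ℓ : ℕ} (c : ZMod ℓ → Pt ℓ) (i : Bool) (j : ZMod ℓ) : Prop :=
  (c j).2 = i ∧ (c (j + 1)).2 = i

/-- A representative of the (±) pure difference of the `j`-th edge of `c`. -/
def pureDiff {ℓ : ℕ} (c : ZMod ℓ → Pt ℓ) (j : ZMod ℓ) : ZMod (2 * ℓ) :=
  (c (j + 1)).1 - (c j).1

/-- The cycTranslate of the cycle `c` by `t`: add `t` to every first coordinate. -/
def cycTranslate {ℓ : ℕ} (t : ZMod (2 * ℓ)) (c : ZMod ℓ → Pt ℓ) : ZMod ℓ → Pt ℓ :=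
  fun j => ((c j).1 + t, (c j).2)

/-- Number of vertices of the cycle `c` coloured `true` (red). -/
def redCount {V : Type} {n : ℕ} [NeZero n] (colour : V → Bool) (c : ZMod n → V) : ℕ :=
  (Finset.univ.filter fun j => colour (c j) = true).card

/-- The cycle `c` is equitably 2-coloured: each colour appears on
`⌊n/2⌋` or `⌈n/2⌉` of its vertices. -/
def IsEquitable {V : Type} {n : ℕ} [NeZero n] (colour : V → Bool) (c : ZMod n → V) : Prop :=
  redCount colour c = n / 2 ∨ redCount colour c = (n + 1) / 2

def pF (k : ℕ) (x c : ℤ) (i : ℕ) : ℤ :=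
  if i = 0 then 2 * k + 1 else if i = 1 then 1 else if i = 2 then x
  else if i % 2 = 1 then c + (i / 2 : ℕ) - 1 else c + k - (i / 2 : ℕ)

def sF (k : ℕ) (j : ℕ) : ℕ :=
  if j < k then j else if j ≤ 2 * k - 3 then 2 * k - 1 - j else j - (2 * k - 2)

def tF (k : ℕ) (i : ℕ) : ℕ :=
  if i = 0 then 2 * k - 2 else if i = 1 then 2 * k - 1 else 2 * k - 1 - i

def gF (k : ℕ) (x c : ℤ) (j : ℕ) : ℤ :=
  if j = 2 * k then 0 else pF k x c (sF k j)

def dF (k : ℕ) (x c : ℤ) (i : ℕ) : ℤ :=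
  if i = 0 then 2 * k else if i = 1 then x - 1 else if i = 2 then x - c else k + 1 - i

def eF (k : ℕ) (x c : ℤ) (j : ℕ) : ℤ :=
  if j < k then dF k x c j else if j ≤ 2 * k - 4 then dF k x c (2 * k - 2 - j)
  else if j = 2 * k - 3 then 2 * k + 1 - x else if j = 2 * k - 2 then 2 * k else 1

def okF (k : ℕ) (x c : ℤ) (m : ℕ) : Prop :=
  3 ≤ k ∧ ((k + 1 ≤ m ∧ m ≤ 2 * k - 2 ∧ 4 ≤ k ∧ x = k + 1 ∧ c = 2) ∨
    (m = k ∧ x = 2 * k - 1 ∧ c = k) ∨ (m + 1 = k ∧ 4 ≤ k ∧ x = 2 * k - 1 ∧ c = k - 1))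

lemma pF_range {k m : ℕ} {x c : ℤ} (h : okF k x c m) {i : ℕ} (hi : i < k) :
    1 ≤ pF k x c i ∧ pF k x c i ≤ 2 * k + 1 := by
  unfold okF at h; unfold pF; split_ifs <;> omega

lemma pF_inj {k m : ℕ} {x c : ℤ} (h : okF k x c m) {i i' : ℕ} (hi : i < k) (hi' : i' < k)
    (e : pF k x c i = pF k x c i') : i = i' := by
  unfold okF at h; unfold pF at e; split_ifs at e <;> omega

lemma pF_diff {k m : ℕ} {x c : ℤ} (h : okF k x c m) {i : ℕ} (hi : i + 1 < k) :
    pF k x c (i + 1) - pF k x c i = dF k x c i ∨ pF k x c (i + 1) - pF k x c i = - dF k x c i := by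
  unfold okF at h
  obtain hi | hi | hi | hi : i = 0 ∨ i = 1 ∨ i = 2 ∨ 3 ≤ i := by omega
  · subst hi; simp [pF, dF]
  · subst hi; simp [pF, dF]
  · subst hi; simp [pF, dF]
  · have d : dF k x c i = k + 1 - i := by
      unfold dF
      rw [if_neg (show ¬ i = 0 by omega), if_neg (show ¬ i = 1 by omega),
        if_neg (show ¬ i = 2 by omega)]
    have q : ∀ s : ℕ, 1 ≤ s → pF k x c (2 * s + 1) = c + s - 1 := by
      intro s hs
      unfold pF
      rw [if_neg (show ¬ 2 * s + 1 = 0 by omega), if_neg (show ¬ 2 * s + 1 = 1 by omega),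
        if_neg (show ¬ 2 * s + 1 = 2 by omega), if_pos (show (2 * s + 1) % 2 = 1 by omega),
        show (2 * s + 1) / 2 = s by omega]
    have q' : ∀ s : ℕ, 2 ≤ s → pF k x c (2 * s) = c + k - s := by
      intro s hs
      unfold pF
      rw [if_neg (show ¬ 2 * s = 0 by omega), if_neg (show ¬ 2 * s = 1 by omega),
        if_neg (show ¬ 2 * s = 2 by omega), if_neg (show ¬ (2 * s) % 2 = 1 by omega),
        show (2 * s) / 2 = s by omega]
    rw [d]
    rcases Nat.even_or_odd' i with ⟨s, rfl | rfl⟩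
    · rw [q s (by omega), q' s (by omega)]; omega
    · rw [q s (by omega), show 2 * s + 1 + 1 = 2 * (s + 1) by ring, q' (s + 1) (by omega)]; omega

lemma sF_lt {k j : ℕ} (hk : 3 ≤ k) (hj : j < 2 * k) : sF k j < k := by
  unfold sF; split_ifs <;> omega

lemma gF_range {k m : ℕ} {x c : ℤ} (h : okF k x c m) {j : ℕ} (hj : j < 2 * k + 1) :
    0 ≤ gF k x c j ∧ gF k x c j ≤ 2 * k + 1 := by
  unfold gF
  split_ifs with h1
  · omega
  · have := pF_range h (sF_lt h.1 (show j < 2 * k by omega)); omega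

lemma gF_inj {k m : ℕ} {x c : ℤ} (h : okF k x c m) {j j' : ℕ} (hj : j < 2 * k + 1)
    (hj' : j' < 2 * k + 1) (hp : k ≤ j ↔ k ≤ j') (e : gF k x c j = gF k x c j') : j = j' := by
  have hk := h.1
  unfold gF at e
  split_ifs at e with h1 h2 h2
  · omega
  · have := pF_range h (sF_lt h.1 (show j' < 2 * k by omega)); omega
  · have := pF_range h (sF_lt h.1 (show j < 2 * k by omega)); omega
  · have := pF_inj h (sF_lt hk (show j < 2 * k by omega)) (sF_lt hk (show j' < 2 * k by omega)) e
    unfold sF at this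
    split_ifs at this <;> omega

lemma gF_diff {k m : ℕ} {x c : ℤ} (h : okF k x c m) {j : ℕ} (hj : j < 2 * k) (hj' : j + 1 ≠ k) :
    gF k x c (j + 1) - gF k x c j = eF k x c j ∨ gF k x c (j + 1) - gF k x c j = - eF k x c j := by
  have hk := h.1
  by_cases h1 : j < k
  · have := pF_diff h (show j + 1 < k by omega)
    have a1 : gF k x c (j + 1) = pF k x c (j + 1) := by
      unfold gF sF; rw [if_neg (by omega), if_pos (by omega)]
    have a2 : gF k x c j = pF k x c j := by
      unfold gF sF; rw [if_neg (by omega), if_pos (by omega)]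
    have a3 : eF k x c j = dF k x c j := by unfold eF; rw [if_pos h1]
    rw [a1, a2, a3]; exact this
  by_cases h2 : j ≤ 2 * k - 4
  · have := pF_diff h (show (2 * k - 2 - j) + 1 < k by omega)
    have a1 : gF k x c (j + 1) = pF k x c (2 * k - 2 - j) := by
      unfold gF sF; rw [if_neg (by omega), if_neg (by omega), if_pos (by omega)]; congr 1; omega
    have a2 : gF k x c j = pF k x c (2 * k - 2 - j + 1) := by
      unfold gF sF; rw [if_neg (by omega), if_neg (by omega), if_pos (by omega)]; congr 1; omega
    have a3 : eF k x c j = dF k x c (2 * k - 2 - j) := by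
      unfold eF; rw [if_neg h1, if_pos h2]
    rw [a1, a2, a3]; omega
  have v : ∀ i, k ≤ i → i < 2 * k → gF k x c i = pF k x c (sF k i) := by
    intro i _ h4; unfold gF; rw [if_neg (by omega)]
  have s3 : sF k (2 * k - 3) = 2 := by unfold sF; split_ifs <;> omega
  have s2 : sF k (2 * k - 2) = 0 := by unfold sF; split_ifs <;> omega
  have s1 : sF k (2 * k - 1) = 1 := by unfold sF; split_ifs <;> omega
  have p0 : pF k x c 0 = 2 * k + 1 := by simp [pF]
  have p1 : pF k x c 1 = 1 := by simp [pF]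
  have p2 : pF k x c 2 = x := by simp [pF]
  have h3 : j = 2 * k - 3 ∨ j = 2 * k - 2 ∨ j = 2 * k - 1 := by omega
  unfold eF
  rw [if_neg h1, if_neg h2]
  rcases h3 with h3 | h3 | h3
  · rw [if_pos h3, v j (by omega) (by omega), v (j + 1) (by omega) (by omega),
      show j + 1 = 2 * k - 2 by omega, h3, s3, s2, p0, p2]
    omega
  · rw [if_neg (by omega), if_pos h3, v j (by omega) (by omega), v (j + 1) (by omega) (by omega),
      show j + 1 = 2 * k - 1 by omega, h3, s2, s1, p0, p1]
    omega
  · rw [if_neg (by omega), if_neg (by omega), v j (by omega) (by omega),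
      show j + 1 = 2 * k by omega, h3, s1, p1]
    unfold gF
    simp

lemma eF_range {k m : ℕ} {x c : ℤ} (h : okF k x c m) {j : ℕ} (hj : j < 2 * k) (hj' : j + 1 ≠ k) :
    1 ≤ eF k x c j ∧ eF k x c j ≤ 2 * k ∧ eF k x c j ≠ m ∧ (j < k → eF k x c j ≠ 2) := by
  unfold okF at h; unfold eF dF; split_ifs <;> omega

lemma dF_inj {k m : ℕ} {x c : ℤ} (h : okF k x c m) {i j : ℕ} (hj : j + 1 < k)
    (hi : i + 1 < k) (e : dF k x c i = dF k x c j) : i = j := by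
  unfold okF at h; unfold dF at e
  split_ifs at e <;> omega

lemma dF_ne {k m : ℕ} {x c : ℤ} (h : okF k x c m) {i : ℕ} (hj : 2 ≤ i) (hi : i + 1 < k) :
    dF k x c i ≠ 1 ∧ dF k x c i ≠ 2 * k ∧ dF k x c i ≠ 2 * k + 1 - x := by
  unfold okF at h; unfold dF
  split_ifs <;> omega

lemma eF_inj {k m : ℕ} {x c : ℤ} (h : okF k x c m) {i j : ℕ} (hj : j < 2 * k) (hj' : j + 1 ≠ k)
    (hi : i < 2 * k) (hi' : i + 1 ≠ k) (hp : k ≤ i ↔ k ≤ j) (e : eF k x c i = eF k x c j) :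
    i = j := by
  have hk := h.1
  unfold eF at e
  by_cases h1 : k ≤ i
  · have h2 := hp.1 h1
    rw [if_neg (show ¬ i < k by omega), if_neg (show ¬ j < k by omega)] at e
    by_cases a1 : i ≤ 2 * k - 4 <;> by_cases a2 : j ≤ 2 * k - 4
    · rw [if_pos a1, if_pos a2] at e
      have := dF_inj h (by omega) (by omega) e
      omega
    · have := dF_ne h (show 2 ≤ 2 * k - 2 - i by omega) (by omega)
      rw [if_pos a1, if_neg a2] at e
      split_ifs at e <;> omega
    · have := dF_ne h (show 2 ≤ 2 * k - 2 - j by omega) (by omega)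
      rw [if_neg a1, if_pos a2] at e
      split_ifs at e <;> omega
    · rw [if_neg a1, if_neg a2] at e
      unfold okF at h
      split_ifs at e <;> omega
  · rw [if_pos (show i < k by omega), if_pos (show j < k by omega)] at e
    exact dF_inj h (by omega) (by omega) e

lemma gF_tF {k : ℕ} {x c : ℤ} (hk : 3 ≤ k) {i : ℕ} (hi : i < k) :
    gF k x c (tF k i) = gF k x c i := by
  have a : sF k (tF k i) = sF k i := by unfold sF tF; split_ifs <;> omega
  have b : tF k i ≠ 2 * k := by unfold tF; split_ifs <;> omega
  unfold gF
  rw [if_neg b, if_neg (by omega), a]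

lemma gF_join {k : ℕ} {x c : ℤ} (hk : 3 ≤ k) : gF k x c k = gF k x c (k - 1) := by
  have : tF k (k - 1) = k := by unfold tF; split_ifs <;> omega
  rw [← gF_tF hk (show k - 1 < k by omega), this]

lemma cast_small {n : ℕ} {a b : ℤ} (h1 : a - b < n) (h2 : b - a < n)
    (h : (a : ZMod n) = (b : ZMod n)) : a = b := by
  rw [ZMod.intCast_eq_intCast_iff_dvd_sub] at h
  obtain ⟨q, hq⟩ := h
  have : q < 1 := by by_contra hh; nlinarith
  have : -1 < q := by by_contra hh; nlinarith
  obtain rfl : q = 0 := by omega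
  linarith

lemma card_val {n : ℕ} [NeZero n] (P : ℕ → Prop) [DecidablePred P] :
    (Finset.univ.filter fun j : ZMod n => P j.val).card = ((Finset.range n).filter P).card := by
  apply Finset.card_bij (fun j _ => j.val)
  · intro a ha; simp at ha ⊢; exact ⟨ZMod.val_lt a, ha⟩
  · intro a _ b _ h; exact ZMod.val_injective _ h
  · intro b hb; simp at hb
    exact ⟨(b : ZMod n), by simp [ZMod.val_natCast, Nat.mod_eq_of_lt hb.1, hb.2],
      by simp [ZMod.val_natCast, Nat.mod_eq_of_lt hb.1]⟩

lemma count_half {k : ℕ} (hk : 3 ≤ k) (R : ℕ → Prop) [DecidablePred R]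
    (hR : ∀ i < k, (R (tF k i) ↔ ¬ R i)) :
    ((Finset.range (2 * k + 1)).filter R).card = k ∨
    ((Finset.range (2 * k + 1)).filter R).card = k + 1 := by
  rw [Finset.card_filter, Finset.sum_range_succ]
  have h1 : ∑ i ∈ Finset.range (2 * k), (if R i then 1 else 0) = k := by
    rw [← Finset.sum_range_add_sum_Ico _ (show k ≤ 2 * k by omega)]
    have h2 : ∑ i ∈ Finset.Ico k (2 * k), (if R i then 1 else 0)
        = ∑ i ∈ Finset.range k, (if R (tF k i) then 1 else 0) := by
      symm
      apply Finset.sum_nbij' (tF k) (sF k)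
      · intro a ha; simp at ha ⊢; unfold tF; split_ifs <;> omega
      · intro a ha; simp at ha ⊢; exact sF_lt hk ha.2
      · intro a ha; simp at ha; unfold sF tF; split_ifs <;> omega
      · intro a ha; simp at ha; unfold sF tF; split_ifs <;> omega
      · intro a ha; rfl
    rw [h2, ← Finset.sum_add_distrib]
    rw [Finset.sum_congr rfl (g := fun _ => 1)]
    · simp
    · intro i hi
      have := hR i (by simpa using hi)
      by_cases h : R i <;> simp [h, this]
  rw [h1]
  split_ifs <;> simp

theorem stmt6 (ℓ m : ℕ) (hodd : Odd ℓ)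
    (hcase : (9 ≤ ℓ ∧ (ℓ - 3) / 2 ≤ m ∧ m ≤ ℓ - 3) ∨ (ℓ = 7 ∧ m = 3)) :
    letI : NeZero ℓ := ⟨by omega⟩
    ∃ c : ZMod ℓ → Pt ℓ,
      Function.Injective c ∧
      -- exactly (ℓ-3)/2 edges are 0-pure and exactly (ℓ-1)/2 edges are 1-pure,
      (Finset.univ.filter fun j => pureEdge c false j).card = (ℓ - 3) / 2 ∧
      (Finset.univ.filter fun j => pureEdge c true j).card = (ℓ - 1) / 2 ∧
      -- with pairwise distinct (±) pure differences within each part,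
      (∀ i : Bool, ∀ j j', pureEdge c i j → pureEdge c i j' → j ≠ j' →
        pureDiff c j ≠ pureDiff c j' ∧ pureDiff c j ≠ -pureDiff c j') ∧
      -- and exactly two mixed edges, of mixed differences 0 and ℓ;
      (∃ j₀ j₁ : ZMod ℓ, j₀ ≠ j₁ ∧ mixedEdge c j₀ ∧ mixedEdge c j₁ ∧
        mixedDiff c j₀ = 0 ∧ mixedDiff c j₁ = (ℓ : ZMod (2 * ℓ)) ∧
        (∀ j, mixedEdge c j → j = j₀ ∨ j = j₁)) ∧
      -- (i) no edge of 0-pure difference ±2, ±m or ℓ, nor of 1-pure difference ±m or ℓ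
      (∀ j, pureEdge c false j →
        pureDiff c j ∉ ({2, -2, (m : ZMod (2 * ℓ)), -(m : ZMod (2 * ℓ)),
          (ℓ : ZMod (2 * ℓ))} : Set (ZMod (2 * ℓ)))) ∧
      (∀ j, pureEdge c true j →
        pureDiff c j ∉ ({(m : ZMod (2 * ℓ)), -(m : ZMod (2 * ℓ)),
          (ℓ : ZMod (2 * ℓ))} : Set (ZMod (2 * ℓ)))) ∧
      -- (ii) if x₀ is a vertex of c then so is x₁
      (∀ x : ZMod (2 * ℓ), (∃ j, c j = (x, false)) → ∃ j, c j = (x, true)) ∧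
      -- (iii) every translate of c is equitably 2-coloured
      (∀ t : ZMod (2 * ℓ), IsEquitable (stdColour ℓ) (cycTranslate t c)) := by
  obtain ⟨k, rfl⟩ := hodd
  obtain ⟨x, c, h⟩ : ∃ x c, okF k x c m := by
    unfold okF
    by_cases h1 : k + 1 ≤ m
    · exact ⟨k + 1, 2, by omega⟩
    by_cases h2 : m = k
    · exact ⟨2 * k - 1, k, by omega⟩
    · exact ⟨2 * k - 1, k - 1, by omega⟩
  have hk := h.1
  have : NeZero (2 * k + 1) := ⟨by omega⟩
  have : Fact (1 < 2 * k + 1) := ⟨by omega⟩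
  have hlt : ∀ j : ZMod (2 * k + 1), j.val < 2 * k + 1 := fun j => ZMod.val_lt j
  have hs1 : ∀ j : ZMod (2 * k + 1), j.val < 2 * k → (j + 1).val = j.val + 1 := by
    intro j hj
    rw [ZMod.val_add, ZMod.val_one, Nat.mod_eq_of_lt (by omega)]
  have hs2 : ∀ j : ZMod (2 * k + 1), j.val = 2 * k → (j + 1).val = 0 := by
    intro j hj
    rw [ZMod.val_add, ZMod.val_one, hj, Nat.mod_self]
  have hof : ∀ i < 2 * k + 1, ∃ j : ZMod (2 * k + 1), j.val = i := fun i hi =>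
    ⟨(i : ZMod (2 * k + 1)), by rw [ZMod.val_natCast, Nat.mod_eq_of_lt hi]⟩
  let C : ZMod (2 * k + 1) → Pt (2 * k + 1) :=
    fun j => (((gF k x c j.val : ℤ) : ZMod (2 * (2 * k + 1))), decide (k ≤ j.val))
  have pf : ∀ j, pureEdge C false j ↔ j.val < k - 1 := by
    intro j
    have := hlt j
    rcases Nat.lt_or_ge j.val (2 * k) with hj | hj
    · simp only [pureEdge, C, hs1 j hj, decide_eq_false_iff_not]; omega
    · simp only [pureEdge, C, hs2 j (by omega), decide_eq_false_iff_not]; omega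
  have pt : ∀ j, pureEdge C true j ↔ (k ≤ j.val ∧ j.val < 2 * k) := by
    intro j
    have := hlt j
    rcases Nat.lt_or_ge j.val (2 * k) with hj | hj
    · simp only [pureEdge, C, hs1 j hj, decide_eq_true_iff]; omega
    · simp only [pureEdge, C, hs2 j (by omega), decide_eq_true_iff]; omega
  have pp : ∀ i j, pureEdge C i j → j.val < 2 * k ∧ j.val + 1 ≠ k ∧ (k ≤ j.val ↔ i = true) := by
    intro i j hj
    cases i
    · rw [pf] at hj; simp; omega
    · rw [pt] at hj; simp; omega
  have pd : ∀ i j, pureEdge C i j →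
      pureDiff C j = ((eF k x c j.val : ℤ) : ZMod (2 * (2 * k + 1))) ∨
      pureDiff C j = ((-eF k x c j.val : ℤ) : ZMod (2 * (2 * k + 1))) := by
    intro i j hj
    obtain ⟨a1, a2, a3⟩ := pp i j hj
    simp only [pureDiff, C, hs1 j a1]
    rw [← Int.cast_sub]
    rcases gF_diff h a1 a2 with e | e <;> rw [e] <;> simp
  have key : ∀ i j, pureEdge C i j → ∀ b : ℤ, -(2 * k + 1) ≤ b → b ≤ 2 * k + 1 →
      pureDiff C j = (b : ZMod (2 * (2 * k + 1))) → b = eF k x c j.val ∨ b = - eF k x c j.val := by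
    intro i j hj b hb1 hb2 e
    obtain ⟨a1, a2, a3⟩ := pp i j hj
    have r := eF_range h a1 a2
    rcases pd i j hj with e' | e' <;> rw [e'] at e
    · left; exact (cast_small (by push_cast; omega) (by push_cast; omega) e).symm
    · right; exact (cast_small (by push_cast; omega) (by push_cast; omega) e).symm
  obtain ⟨j0, hj0⟩ := hof (k - 1) (by omega)
  obtain ⟨j1, hj1⟩ := hof (2 * k) (by omega)
  refine ⟨C, ?_, ?_, ?_, ?_, ⟨j0, j1, ?_, ?_, ?_, ?_, ?_, ?_⟩, ?_, ?_, ?_, ?_⟩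
  · intro j j' e
    simp only [C, Prod.mk.injEq, decide_eq_decide] at e
    have r := gF_range h (hlt j)
    have r' := gF_range h (hlt j')
    have := cast_small (by push_cast; omega) (by push_cast; omega) e.1
    exact ZMod.val_injective _ (gF_inj h (hlt j) (hlt j') e.2 this)
  · simp only [pf]
    rw [card_val (fun i => i < k - 1)]
    have : (Finset.range (2 * k + 1)).filter (fun i => i < k - 1) = Finset.range (k - 1) := by
      ext i; simp; omega
    rw [this, Finset.card_range]; omega
  · simp only [pt]
    rw [card_val (fun i => k ≤ i ∧ i < 2 * k)]
    have : (Finset.range (2 * k + 1)).filter (fun i => k ≤ i ∧ i < 2 * k) = Finset.Ico k (2 * k) := by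
      ext i; simp; omega
    rw [this, Nat.card_Ico]; omega
  · intro i j j' hj hj' hne
    obtain ⟨a1, a2, a3⟩ := pp i j hj
    obtain ⟨b1, b2, b3⟩ := pp i j' hj'
    have r := eF_range h a1 a2
    have r' := eF_range h b1 b2
    have hne' : eF k x c j.val ≠ eF k x c j'.val := fun e =>
      hne (ZMod.val_injective _ (eF_inj h b1 b2 a1 a2 (a3.trans b3.symm) e))
    constructor <;> intro e
    · rcases pd i j' hj' with e' | e' <;> rw [e'] at e
      · have := key i j hj _ (by omega) (by omega) e; omega
      · have := key i j hj _ (by omega) (by omega) e; omega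
    · rcases pd i j' hj' with e' | e' <;> rw [e', ← Int.cast_neg] at e
      · have := key i j hj _ (by omega) (by omega) e; omega
      · have := key i j hj _ (by omega) (by omega) e; omega
  · intro e; rw [e] at hj0; omega
  · simp only [mixedEdge, C, hs1 j0 (by omega), hj0, ne_eq, decide_eq_decide]; omega
  · simp only [mixedEdge, C, hs2 j1 (by omega), hj1, ne_eq, decide_eq_decide]; omega
  · have : k - 1 + 1 = k := by omega
    simp only [mixedDiff, C, hs1 j0 (by omega), hj0, this]
    rw [if_pos (by simp; omega), gF_join hk, sub_self]
  · simp only [mixedDiff, C, hs2 j1 (by omega), hj1]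
    rw [if_neg (by simp; omega)]
    have e1 : gF k x c (2 * k) = 0 := by unfold gF; simp
    have e2 : gF k x c 0 = 2 * k + 1 := by
      have s0 : sF k 0 = 0 := by unfold sF; rw [if_pos (by omega)]
      unfold gF; rw [if_neg (by omega), s0]; simp [pF]
    rw [e1, e2, ← Int.cast_sub, ← Int.cast_natCast (R := ZMod (2 * (2 * k + 1))),
      ZMod.intCast_eq_intCast_iff_dvd_sub]
    exact ⟨1, by push_cast; ring⟩
  · intro j hj
    have := hlt j
    rcases Nat.lt_or_ge j.val (2 * k) with hj' | hj'
    · left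
      simp only [mixedEdge, C, hs1 j hj', ne_eq, decide_eq_decide] at hj
      exact ZMod.val_injective _ (by omega)
    · right; exact ZMod.val_injective _ (by omega)
  · intro j hj hm
    obtain ⟨a1, a2, a3⟩ := pp false j hj
    have r := eF_range h a1 a2
    have hm2 : m ≤ 2 * k - 2 := by unfold okF at h; omega
    have hjk : j.val < k := by rw [pf] at hj; omega
    have r2 := r.2.2.2 hjk
    simp only [Set.mem_insert_iff, Set.mem_singleton_iff] at hm
    rcases hm with e | e | e | e | e
    · have := key _ j hj 2 (by omega) (by omega) (by rw [e]; simp); omega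
    · have := key _ j hj (-2) (by omega) (by omega) (by rw [e]; simp); omega
    · have := key _ j hj m (by omega) (by omega) (by rw [e]; simp); omega
    · have := key _ j hj (-m) (by omega) (by omega) (by rw [e]; simp); omega
    · have := key _ j hj (2 * k + 1) (by omega) (by omega) (by rw [e]; push_cast; rfl); omega
  · intro j hj hm
    obtain ⟨a1, a2, a3⟩ := pp true j hj
    have r := eF_range h a1 a2
    have hm2 : m ≤ 2 * k - 2 := by unfold okF at h; omega
    simp only [Set.mem_insert_iff, Set.mem_singleton_iff] at hm
    rcases hm with e | e | e
    · have := key _ j hj m (by omega) (by omega) (by rw [e]; simp); omega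
    · have := key _ j hj (-m) (by omega) (by omega) (by rw [e]; simp); omega
    · have := key _ j hj (2 * k + 1) (by omega) (by omega) (by rw [e]; push_cast; rfl); omega
  · rintro y ⟨j, hj⟩
    simp only [C, Prod.mk.injEq, decide_eq_false_iff_not] at hj
    have ht : k ≤ tF k j.val ∧ tF k j.val < 2 * k + 1 := by unfold tF; split_ifs <;> omega
    obtain ⟨i, hi⟩ := hof _ ht.2
    refine ⟨i, ?_⟩
    simp only [C, Prod.mk.injEq, hi, gF_tF hk (show j.val < k by omega), decide_eq_true_iff]
    exact ⟨hj.1, ht.1⟩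
  · intro t
    have e := card_val (n := 2 * k + 1) (fun i => stdColour (2 * k + 1)
      (((gF k x c i : ℤ) : ZMod (2 * (2 * k + 1))) + t, decide (k ≤ i)) = true)
    have f := count_half hk (fun i => stdColour (2 * k + 1)
      (((gF k x c i : ℤ) : ZMod (2 * (2 * k + 1))) + t, decide (k ≤ i)) = true) (by
        intro i hi
        have ht : k ≤ tF k i := by unfold tF; split_ifs <;> omega
        have hi' : ¬ k ≤ i := by omega
        simp [stdColour, gF_tF hk hi, ht, hi'])
    rw [← e] at f
    have g1 : (2 * k + 1) / 2 = k := by omega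
    have g2 : (2 * k + 1 + 1) / 2 = k + 1 := by omega
    unfold IsEquitable redCount
    rw [g1, g2]
    exact f
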